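/- There is an absolute constant C such that the following holds: for every integer n ≥ 2, every real α, and all integers a and q with 1 ≤ q ≤ n, gcd(a, q) = 1, and |q·α − a| ≤ 1/q, the exponential sum f(α) = ∑_{p ≤ n} e(α·p) over primes p satisfies |f(α)| ≤ C·(log n)³·(n·q^{−1/2} + n^{4/5} + n^{1/2}·q^{1/2}). -/

import Mathlib

/-- `e(α) = exp(2πiα)`. -/
noncomputable def eAdd (α : ℝ) : ℂ := Complex.exp (2 * Real.pi * Complex.I * α)

/-- The exponential sum `f(α) = ∑_{p ≤ n} e(αp)` over primes `p ≤ n`. -/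
noncomputable def primeExpSum (n : ℕ) (α : ℝ) : ℂ :=
  ∑ p ∈ (Finset.range (n + 1)).filter Nat.Prime, eAdd (α * p)

open Finset

/-! ### The additive character and the distance to the nearest integer -/

theorem norm_eAdd (x : ℝ) : ‖eAdd x‖ = 1 := by
  have h : (2 * Real.pi * Complex.I * x : ℂ) = ((2 * Real.pi * x : ℝ) : ℂ) * Complex.I := by
    push_cast; ring
  rw [eAdd, h, Complex.norm_exp_ofReal_mul_I]

theorem eAdd_add (x y : ℝ) : eAdd (x + y) = eAdd x * eAdd y := by
  rw [eAdd, eAdd, eAdd, ← Complex.exp_add]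
  push_cast; ring_nf

theorem eAdd_intCast (k : ℤ) : eAdd k = 1 := by
  rw [eAdd, Complex.exp_eq_one_iff]
  exact ⟨k, by push_cast; ring⟩

theorem star_eAdd (x : ℝ) : star (eAdd x) = eAdd (-x) := by
  rw [eAdd, eAdd, Complex.star_def, ← Complex.exp_conj]
  simp [map_ofNat]

/-- The distance from a real number to the nearest integer. -/
noncomputable def distInt (x : ℝ) : ℝ := |x - round x|

theorem distInt_le (x : ℝ) (k : ℤ) : distInt x ≤ |x - k| := round_le x k

theorem distInt_neg (x : ℝ) : distInt (-x) = distInt x := by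
  apply le_antisymm
  · refine (distInt_le _ (-round x)).trans_eq ?_
    rw [distInt, ← abs_neg]; push_cast; congr 1; ring
  · refine (distInt_le _ (-round (-x))).trans_eq ?_
    rw [distInt, ← abs_neg]; push_cast; congr 1; ring

theorem four_mul_distInt_le_norm_eAdd_sub_one (x : ℝ) : 4 * distInt x ≤ ‖eAdd x - 1‖ := by
  set y := x - round x with hy
  have h1 : eAdd x = eAdd y := by
    have := eAdd_add y (round x)
    rwa [eAdd_intCast, mul_one, hy, sub_add_cancel] at this
  have h2 : (2 * Real.pi * Complex.I * y : ℂ) = Complex.I * ((2 * Real.pi * y : ℝ) : ℂ) := by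
    push_cast; ring
  have hy2 : |y| ≤ 1 / 2 := abs_sub_round x
  have h3 := Real.mul_abs_le_abs_sin (x := Real.pi * y) (by
    rw [abs_mul, abs_of_pos Real.pi_pos]
    nlinarith [Real.pi_pos])
  rw [h1, eAdd, h2, Complex.norm_exp_I_mul_ofReal_sub_one, Real.norm_eq_abs, abs_mul,
    show 2 * Real.pi * y / 2 = Real.pi * y by ring, abs_two, distInt]
  rw [abs_mul, abs_of_pos Real.pi_pos, ← mul_assoc, div_mul_cancel₀ _ Real.pi_pos.ne'] at h3
  linarith

theorem norm_sum_eAdd_mul_distInt_le (β : ℝ) (u v : ℕ) :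
    ‖∑ k ∈ Ioc u v, eAdd (β * k)‖ * distInt β ≤ 1 := by
  rcases le_total v u with h | h
  · simp [Ioc_eq_empty_of_le h]
  have hpow (k : ℕ) : eAdd (β * (k + 1 : ℕ)) = eAdd (β * k) * eAdd β := by
    rw [← eAdd_add]; push_cast; ring_nf
  have htel : (∑ k ∈ Ioc u v, eAdd (β * k)) * (eAdd β - 1)
      = eAdd (β * (v + 1 : ℕ)) - eAdd (β * (u + 1 : ℕ)) := by
    induction v, h using Nat.le_induction with
    | base => simp
    | succ m hm ih =>
      rw [← Finset.insert_Ioc_right_eq_Ioc_add_one hm, sum_insert (by simp), add_mul, ih,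
        hpow (m + 1)]
      ring
  have h1 : ‖∑ k ∈ Ioc u v, eAdd (β * k)‖ * ‖eAdd β - 1‖ ≤ 2 := by
    rw [← norm_mul, htel]
    refine (norm_sub_le _ _).trans ?_
    rw [norm_eAdd, norm_eAdd]; norm_num
  have h2 := mul_le_mul_of_nonneg_left (four_mul_distInt_le_norm_eAdd_sub_one β)
    (norm_nonneg (∑ k ∈ Ioc u v, eAdd (β * k)))
  linarith

/-- The minimum of `M` and `1 / d`, read as `M` when `d = 0`. -/
noncomputable def minInv (M d : ℝ) : ℝ := M / max 1 (M * d)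

theorem minInv_nonneg {M : ℝ} (hM : 0 ≤ M) (d : ℝ) : 0 ≤ minInv M d :=
  div_nonneg hM (zero_le_one.trans (le_max_left _ _))

theorem minInv_le {M : ℝ} (hM : 0 ≤ M) (d : ℝ) : minInv M d ≤ M :=
  div_le_self hM (le_max_left _ _)

theorem minInv_mul_le (M d : ℝ) : minInv M d * d ≤ 1 := by
  rw [minInv, div_mul_eq_mul_div, div_le_one (by positivity)]
  exact le_max_right _ _

theorem le_minInv {M d x : ℝ} (hx : 0 ≤ x) (hxM : x ≤ M) (hxd : x * d ≤ 1) : x ≤ minInv M d := by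
  rw [minInv, le_div_iff₀ (by positivity)]
  rcases max_cases 1 (M * d) with ⟨h, _⟩ | ⟨h, _⟩ <;> rw [h]
  · simpa
  · nlinarith

theorem minInv_mono {M N : ℝ} (hM : 0 ≤ M) (h : M ≤ N) (d : ℝ) : minInv M d ≤ minInv N d :=
  le_minInv (minInv_nonneg hM d) ((minInv_le hM d).trans h) (minInv_mul_le M d)

theorem norm_sum_eAdd_le_minInv (β : ℝ) (u v : ℕ) {M : ℝ} (hM : (v : ℝ) ≤ M) :
    ‖∑ k ∈ Ioc u v, eAdd (β * k)‖ ≤ minInv M (distInt β) := by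
  refine le_minInv (norm_nonneg _) ?_ (norm_sum_eAdd_mul_distInt_le β u v)
  refine (norm_sum_le _ _).trans ?_
  simp only [norm_eAdd, sum_const, Nat.card_Ioc, nsmul_eq_mul, mul_one]
  exact (Nat.cast_le.2 (Nat.sub_le _ _)).trans hM

/-! ### Partial summation -/

theorem norm_sum_antitone_mul_le {w : ℕ → ℝ} (hw : Antitone w) (hw0 : ∀ k, 0 ≤ w k) {z : ℕ → ℂ}
    {B : ℝ} {u v : ℕ} (hz : ∀ m ≤ v, ‖∑ k ∈ Ioc u m, z k‖ ≤ B) :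
    ‖∑ k ∈ Ioc u v, (w k : ℂ) * z k‖ ≤ w u * B := by
  have hB : 0 ≤ B := (norm_nonneg _).trans (hz 0 (Nat.zero_le _))
  rcases le_total v u with h | h
  · simpa [Ioc_eq_empty_of_le h] using mul_nonneg (hw0 u) hB
  have key : ‖∑ k ∈ Ioc u v, (w k : ℂ) * z k - w v * ∑ k ∈ Ioc u v, z k‖ ≤ (w u - w v) * B := by
    induction v, h using Nat.le_induction with
    | base => simp
    | succ m hm ih =>
      have hstep : ∑ k ∈ Ioc u (m + 1), (w k : ℂ) * z k - w (m + 1) * ∑ k ∈ Ioc u (m + 1), z k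
          = (∑ k ∈ Ioc u m, (w k : ℂ) * z k - w m * ∑ k ∈ Ioc u m, z k)
            + ((w m - w (m + 1) : ℝ) : ℂ) * ∑ k ∈ Ioc u m, z k := by
        rw [← Finset.insert_Ioc_right_eq_Ioc_add_one hm, sum_insert (by simp),
          sum_insert (by simp)]
        push_cast; ring
      have hd : 0 ≤ w m - w (m + 1) := sub_nonneg.2 (hw m.le_succ)
      rw [hstep]
      refine (norm_add_le _ _).trans ?_
      rw [norm_mul, Complex.norm_real, Real.norm_of_nonneg hd]
      have h1 := ih fun j hj => hz j (hj.trans m.le_succ)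
      have h2 := mul_le_mul_of_nonneg_left (hz m m.le_succ) hd
      linarith
  have h1 : ‖(w v : ℂ) * ∑ k ∈ Ioc u v, z k‖ ≤ w v * B := by
    rw [norm_mul, Complex.norm_real, Real.norm_of_nonneg (hw0 v)]
    exact mul_le_mul_of_nonneg_left (hz v le_rfl) (hw0 v)
  have h2 := norm_add_le (∑ k ∈ Ioc u v, (w k : ℂ) * z k - w v * ∑ k ∈ Ioc u v, z k)
    (w v * ∑ k ∈ Ioc u v, z k)
  rw [sub_add_cancel] at h2
  linarith

theorem norm_sum_monotone_mul_le {w : ℕ → ℝ} (hw : Monotone w) (hw0 : ∀ k, 0 ≤ w k) {z : ℕ → ℂ}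
    {B : ℝ} {u v : ℕ} (hz : ∀ m ≤ v, ‖∑ k ∈ Ioc u m, z k‖ ≤ B) :
    ‖∑ k ∈ Ioc u v, (w k : ℂ) * z k‖ ≤ 2 * w v * B := by
  have hB : 0 ≤ B := (norm_nonneg _).trans (hz 0 (Nat.zero_le _))
  have h1 := norm_sum_antitone_mul_le (w := fun k => max (w v - w k) 0) (u := u) (v := v)
    (fun i j h => max_le_max (sub_le_sub_left (hw h) _) le_rfl) (fun k => le_max_right _ _) hz
  have h2 : ∑ k ∈ Ioc u v, (w k : ℂ) * z k
      = w v * ∑ k ∈ Ioc u v, z k - ∑ k ∈ Ioc u v, ((max (w v - w k) 0 : ℝ) : ℂ) * z k := by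
    rw [mul_sum, ← sum_sub_distrib]
    refine sum_congr rfl fun k hk => ?_
    rw [max_eq_left (sub_nonneg.2 (hw (mem_Ioc.1 hk).2))]
    push_cast; ring
  rw [h2]
  refine (norm_sub_le _ _).trans ?_
  rw [norm_mul, Complex.norm_real, Real.norm_of_nonneg (hw0 v)]
  have h3 := mul_le_mul_of_nonneg_left (hz v le_rfl) (hw0 v)
  have h4 : max (w v - w u) 0 * B ≤ w v * B :=
    mul_le_mul_of_nonneg_right (max_le (by linarith [hw0 u]) (hw0 v)) hB
  linarith

/-! ### Sums over well spaced points -/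

theorem sum_range_inv_le_one_add_log (N : ℕ) :
    ∑ t ∈ range N, ((t : ℝ))⁻¹ ≤ 1 + Real.log N := by
  rcases Nat.eq_zero_or_pos N with rfl | hN
  · simp
  obtain ⟨m, rfl⟩ : ∃ m, N = m + 1 := ⟨N - 1, by omega⟩
  have h := harmonic_le_one_add_log m
  rw [harmonic] at h
  push_cast at h
  rw [sum_range_succ']
  push_cast
  simp only [inv_zero, add_zero]
  rcases Nat.eq_zero_or_pos m with rfl | hm
  · simp
  have := Real.log_le_log (x := m) (y := (m : ℝ) + 1) (by exact_mod_cast hm) (by linarith)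
  linarith

theorem sum_Ioc_inv_le_one_add_log (N : ℕ) :
    ∑ t ∈ Ioc 0 N, ((t : ℝ))⁻¹ ≤ 1 + Real.log N := by
  have h := harmonic_le_one_add_log N
  rw [harmonic_eq_sum_Icc] at h
  push_cast at h
  exact h

theorem lt_distInt_mul_of_abs_sub_le {α : ℝ} {a : ℤ} {q : ℕ} (hq : 1 ≤ q) (hgcd : Int.gcd a q = 1)
    (hα : |(q : ℝ) * α - a| ≤ 1 / q) {h : ℕ} (h0 : 0 < h) (h2 : 2 * h < q) :
    1 / (2 * q : ℝ) < distInt (α * h) := by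
  have hq0 : (0 : ℝ) < q := by exact_mod_cast hq
  set k := round (α * h) with hk
  have hne : a * h - k * q ≠ 0 := by
    intro h1
    have hdvd : (q : ℤ) ∣ a * h := ⟨k, by linarith⟩
    have hcop : IsCoprime (q : ℤ) a := (Int.isCoprime_iff_gcd_eq_one.2 hgcd).symm
    have := Int.le_of_dvd (by exact_mod_cast h0) (hcop.dvd_of_dvd_mul_left hdvd)
    omega
  have h1 : (1 : ℝ) ≤ |(a : ℝ) * h - k * q| := by exact_mod_cast Int.one_le_abs hne
  have h3 : (q : ℝ) * (α * h - k) = (a * h - k * q) + h * (q * α - a) := by ring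
  have h4 : |(h : ℝ) * (q * α - a)| ≤ h * (1 / q) := by
    rw [abs_mul, abs_of_nonneg (Nat.cast_nonneg h)]
    exact mul_le_mul_of_nonneg_left hα (Nat.cast_nonneg h)
  have h5 : (h : ℝ) * (1 / q) < 1 / 2 := by
    rw [mul_one_div, div_lt_div_iff₀ hq0 two_pos]
    have : (2 * h : ℝ) < q := by exact_mod_cast h2
    linarith
  have h6 : |(q : ℝ) * (α * h - k)| = q * distInt (α * h) := by
    rw [abs_mul, abs_of_pos hq0, distInt]
  have h7 : |(a : ℝ) * h - k * q| ≤ |(q : ℝ) * (α * h - k)| + |(h : ℝ) * (q * α - a)| := by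
    rw [h3]
    simpa using abs_sub ((a * h - k * q) + h * (q * α - a) : ℝ) ((h : ℝ) * (q * α - a))
  rw [div_lt_iff₀ (by positivity)]
  nlinarith

theorem sum_block_le {α : ℝ} {a : ℤ} {q : ℕ} (hq : 1 ≤ q) (hgcd : Int.gcd a q = 1)
    (hα : |(q : ℝ) * α - a| ≤ 1 / q) (s : ℕ) {b : ℕ} (hb : 2 * b ≤ q + 1) {φ : ℕ → ℝ} {M : ℝ}
    (hM : 0 ≤ M) (hφ0 : ∀ i < b, 0 ≤ φ (s + i)) (hφM : ∀ i < b, φ (s + i) ≤ M)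
    (hφ : ∀ i < b, φ (s + i) * distInt (α * (s + i : ℕ)) ≤ 1) :
    ∑ i ∈ range b, φ (s + i) ≤ 2 * M + 4 * q * (1 + Real.log (2 * q)) := by
  have hq0 : (0 : ℝ) < q := by exact_mod_cast hq
  set t : ℕ → ℕ := fun i => ⌊2 * q * Int.fract (α * (s + i : ℕ))⌋₊ with ht
  have hfr (i : ℕ) : 0 ≤ 2 * q * Int.fract (α * (s + i : ℕ)) :=
    mul_nonneg (by positivity) (Int.fract_nonneg _)
  have htle (i : ℕ) : (t i : ℝ) ≤ 2 * q * Int.fract (α * (s + i : ℕ)) := Nat.floor_le (hfr i)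
  have hltt (i : ℕ) : 2 * q * Int.fract (α * (s + i : ℕ)) < t i + 1 := Nat.lt_floor_add_one _
  have htq (i : ℕ) : t i < 2 * q := by
    have h1 := Int.fract_lt_one (α * (s + i : ℕ))
    have h2 : (t i : ℝ) < 2 * q := (htle i).trans_lt (by nlinarith)
    exact_mod_cast h2
  have hinj_lt : ∀ i j, i < j → j < b → t i ≠ t j := by
    intro i j hij hj heq
    have h1 := lt_distInt_mul_of_abs_sub_le hq hgcd hα (h := j - i) (by omega) (by omega)
    have h2 := distInt_le (α * (j - i : ℕ)) (⌊α * (s + j : ℕ)⌋ - ⌊α * (s + i : ℕ)⌋)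
    have h3 : α * (j - i : ℕ) - ((⌊α * (s + j : ℕ)⌋ - ⌊α * (s + i : ℕ)⌋ : ℤ) : ℝ)
        = Int.fract (α * (s + j : ℕ)) - Int.fract (α * (s + i : ℕ)) := by
      rw [← Int.self_sub_floor, ← Int.self_sub_floor, Nat.cast_sub hij.le]
      push_cast; ring
    rw [h3] at h2
    have h4 : |Int.fract (α * (s + j : ℕ)) - Int.fract (α * (s + i : ℕ))| < 1 / (2 * q) := by
      rw [lt_div_iff₀ (by positivity), ← abs_of_pos (show (0 : ℝ) < 2 * q by positivity),
        ← abs_mul, abs_lt]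
      have e1 := htle i
      have e2 := htle j
      have e3 := hltt i
      have e4 := hltt j
      rw [heq] at e1 e3
      constructor <;> nlinarith
    linarith
  have hinj : Set.InjOn t (range b : Finset ℕ) := by
    intro i hi j hj heq
    have hi' : i < b := by simpa using hi
    have hj' : j < b := by simpa using hj
    rcases lt_trichotomy i j with h | h | h
    · exact absurd heq (hinj_lt i j h hj')
    · exact h
    · exact absurd heq.symm (hinj_lt j i h hi')
  set F : ℕ → ℝ := fun m => (if m = 0 then M else 0) + (if m = 2 * q - 1 then M else 0)
    + 2 * q * (m : ℝ)⁻¹ + 2 * q * ((2 * q - 1 - m : ℕ) : ℝ)⁻¹ with hF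
  have hF0 (m : ℕ) : 0 ≤ F m := by
    simp only [hF]
    split_ifs <;> positivity
  have hφF : ∀ i < b, φ (s + i) ≤ F (t i) := by
    intro i hi
    have h1 := hφ i hi
    have h0 := hφ0 i hi
    have hp1 : 0 ≤ 2 * q * ((t i : ℕ) : ℝ)⁻¹ := by positivity
    have hp2 : 0 ≤ 2 * q * ((2 * q - 1 - t i : ℕ) : ℝ)⁻¹ := by positivity
    have hi1 : (0 : ℝ) ≤ if t i = 0 then M else 0 := by split_ifs <;> simp [hM]
    have hi2 : (0 : ℝ) ≤ if t i = 2 * q - 1 then M else 0 := by split_ifs <;> simp [hM]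
    rw [distInt, abs_sub_round_eq_min] at h1
    rcases min_choice (Int.fract (α * (s + i : ℕ))) (1 - Int.fract (α * (s + i : ℕ))) with h | h
    · rw [h] at h1
      rcases Nat.eq_zero_or_pos (t i) with h2 | h2
      · have : M ≤ F (t i) := by
          simp only [hF]
          rw [if_pos h2]
          linarith
        exact (hφM i hi).trans this
      · have h3 : φ (s + i) ≤ 2 * q * ((t i : ℕ) : ℝ)⁻¹ := by
          rw [← div_eq_mul_inv, le_div_iff₀ (by exact_mod_cast h2)]
          nlinarith [mul_le_mul_of_nonneg_left (htle i) h0]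
        simp only [hF]
        linarith
    · rw [h] at h1
      rcases Nat.eq_zero_or_pos (2 * q - 1 - t i) with h2 | h2
      · have : M ≤ F (t i) := by
          simp only [hF]
          rw [if_pos (show t i = 2 * q - 1 by have := htq i; omega)] at hi2 ⊢
          linarith
        exact (hφM i hi).trans this
      · have h4 : ((2 * q - 1 - t i : ℕ) : ℝ) = 2 * q - 1 - t i := by
          rw [Nat.cast_sub (by omega), Nat.cast_sub (by omega)]; push_cast; ring
        have h3 : φ (s + i) ≤ 2 * q * ((2 * q - 1 - t i : ℕ) : ℝ)⁻¹ := by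
          rw [← div_eq_mul_inv, le_div_iff₀ (by exact_mod_cast h2), h4]
          nlinarith [mul_le_mul_of_nonneg_left (hltt i).le h0]
        simp only [hF]
        linarith
  calc ∑ i ∈ range b, φ (s + i) ≤ ∑ i ∈ range b, F (t i) :=
        sum_le_sum fun i hi => hφF i (mem_range.1 hi)
    _ = ∑ m ∈ (range b).image t, F m := (sum_image hinj).symm
    _ ≤ ∑ m ∈ range (2 * q), F m := by
        refine sum_le_sum_of_subset_of_nonneg ?_ fun m _ _ => hF0 m
        intro m hm
        obtain ⟨i, -, rfl⟩ := mem_image.1 hm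
        exact mem_range.2 (htq i)
    _ = 2 * M + 2 * q * ∑ m ∈ range (2 * q), (m : ℝ)⁻¹ + 2 * q * ∑ m ∈ range (2 * q), (m : ℝ)⁻¹ := by
        simp only [hF, sum_add_distrib, ← mul_sum]
        rw [sum_range_reflect (fun m => ((m : ℕ) : ℝ)⁻¹), sum_ite_eq', sum_ite_eq',
          if_pos (mem_range.2 (by omega)), if_pos (mem_range.2 (by omega))]
        ring
    _ ≤ 2 * M + 4 * q * (1 + Real.log (2 * q)) := by
        have := sum_range_inv_le_one_add_log (2 * q)
        push_cast at this
        nlinarith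

theorem sum_range_mul_eq_sum_sum {M : Type*} [AddCommMonoid M] (φ : ℕ → M) (J b : ℕ) :
    ∑ h ∈ range (J * b), φ h = ∑ j ∈ range J, ∑ i ∈ range b, φ (j * b + i) := by
  induction J with
  | zero => simp
  | succ J ih => rw [sum_range_succ, ← ih, Nat.add_mul, one_mul, sum_range_add]

theorem two_thirds_le_log {n : ℕ} (hn : 2 ≤ n) : 2 / 3 ≤ Real.log n := by
  have h1 : Real.log 2 ≤ Real.log n := Real.log_le_log two_pos (by exact_mod_cast hn)
  have h2 := Real.log_two_gt_d9
  norm_num at h2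
  linarith

/-- The bound `min (n / h) (1 / ‖α h‖)` for a geometric sum of length `n / h` and
frequency `α h`; it is `0` for `h = 0`. -/
noncomputable def geomBound (n : ℕ) (α : ℝ) (h : ℕ) : ℝ := minInv ((n : ℝ) / h) (distInt (α * h))

theorem geomBound_nonneg (n : ℕ) (α : ℝ) (h : ℕ) : 0 ≤ geomBound n α h :=
  minInv_nonneg (by positivity) _

theorem geomBound_zero (n : ℕ) (α : ℝ) : geomBound n α 0 = 0 := by simp [geomBound, minInv]

theorem sum_geomBound_le {n : ℕ} (hn : 2 ≤ n) {α : ℝ} {a : ℤ} {q : ℕ} (hq : 1 ≤ q) (hqn : q ≤ n)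
    (hgcd : Int.gcd a q = 1) (hα : |(q : ℝ) * α - a| ≤ 1 / q) {X : ℕ} (hX : X ≤ n) :
    ∑ h ∈ range (X + 1), geomBound n α h ≤ 32 * Real.log n * ((n : ℝ) / q + X + q) := by
  have hq0 : (0 : ℝ) < q := by exact_mod_cast hq
  have hn0 : (0 : ℝ) < n := by exact_mod_cast (by omega : 0 < n)
  have hqn' : (q : ℝ) ≤ n := by exact_mod_cast hqn
  set L := Real.log n with hL
  have hL1 : 2 / 3 ≤ L := two_thirds_le_log hn
  have hlog2 : Real.log 2 ≤ L := Real.log_le_log two_pos (by exact_mod_cast hn)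
  have hl : 1 + Real.log (2 * q) ≤ 4 * L := by
    rw [Real.log_mul two_ne_zero hq0.ne']
    linarith [Real.log_le_log hq0 hqn']
  obtain ⟨b, hb1, hb2, hb0⟩ : ∃ b, 2 * b ≤ q + 1 ∧ q ≤ 2 * b ∧ 0 < b :=
    ⟨(q + 1) / 2, by omega, by omega, by omega⟩
  have hb0' : (0 : ℝ) < b := by exact_mod_cast hb0
  have hb2' : (q : ℝ) ≤ 2 * b := by exact_mod_cast hb2
  set J := X / b with hJ
  have hJX : J * b ≤ X := Nat.div_mul_le_self X b
  have hXJ : X + 1 ≤ (J + 1) * b := by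
    rw [mul_comm]; exact Nat.lt_mul_div_succ X hb0
  have hJq : (J : ℝ) * q ≤ 2 * X := by
    have : (J : ℝ) * b ≤ X := by exact_mod_cast hJX
    nlinarith [(Nat.cast_nonneg J : (0 : ℝ) ≤ J)]
  have hfirst : ∑ i ∈ range b, geomBound n α (0 * b + i)
      ≤ 2 * (2 * q) + 4 * q * (1 + Real.log (2 * q)) := by
    refine sum_block_le hq hgcd hα (0 * b) hb1 (by positivity) (fun i _ => geomBound_nonneg _ _ _) ?_
      fun i _ => minInv_mul_le _ _
    intro i hi
    rw [zero_mul, zero_add]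
    rcases Nat.eq_zero_or_pos i with rfl | h0
    · rw [geomBound_zero]; positivity
    · have h1 := lt_distInt_mul_of_abs_sub_le hq hgcd hα h0 (by omega)
      rw [div_lt_iff₀ (by positivity)] at h1
      have h2 : geomBound n α i * distInt (α * i) ≤ 1 := minInv_mul_le _ _
      have h3 := geomBound_nonneg n α i
      nlinarith
  have hother (j : ℕ) : ∑ i ∈ range b, geomBound n α ((j + 1) * b + i)
      ≤ 2 * (n / b * ((j + 1 : ℕ) : ℝ)⁻¹) + 4 * q * (1 + Real.log (2 * q)) := by
    refine sum_block_le hq hgcd hα ((j + 1) * b) hb1 (by positivity)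
      (fun i _ => geomBound_nonneg _ _ _) ?_ fun i _ => minInv_mul_le _ _
    intro i hi
    refine (minInv_le (by positivity) _).trans ?_
    rw [div_mul_eq_mul_div, ← div_eq_mul_inv, div_div]
    refine div_le_div_of_nonneg_left hn0.le (by positivity) ?_
    push_cast
    nlinarith [(Nat.cast_nonneg i : (0 : ℝ) ≤ i)]
  have hharm : ∑ j ∈ range J, ((j + 1 : ℕ) : ℝ)⁻¹ ≤ 3 * L := by
    have h1 := sum_range_inv_le_one_add_log (J + 1)
    have h2 := harmonic_le_one_add_log J
    rw [harmonic] at h2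
    push_cast at h2 ⊢
    have h3 : Real.log J ≤ L := by
      rcases Nat.eq_zero_or_pos J with h | h
      · rw [h]; simp; linarith
      · exact Real.log_le_log (by exact_mod_cast h)
          (by exact_mod_cast ((Nat.div_le_self X b).trans hX))
    linarith
  have hnb : (n : ℝ) / b ≤ 2 * (n / q) := by
    rw [← mul_div_assoc, div_le_div_iff₀ hb0' hq0]
    nlinarith
  calc ∑ h ∈ range (X + 1), geomBound n α h ≤ ∑ h ∈ range ((J + 1) * b), geomBound n α h :=
        sum_le_sum_of_subset_of_nonneg (range_subset_range.2 hXJ) fun _ _ _ => geomBound_nonneg _ _ _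
    _ = (∑ j ∈ range J, ∑ i ∈ range b, geomBound n α ((j + 1) * b + i))
        + ∑ i ∈ range b, geomBound n α (0 * b + i) := by
        rw [sum_range_mul_eq_sum_sum, sum_range_succ']
    _ ≤ (∑ j ∈ range J, (2 * (n / b * ((j + 1 : ℕ) : ℝ)⁻¹) + 4 * q * (1 + Real.log (2 * q))))
        + (2 * (2 * q) + 4 * q * (1 + Real.log (2 * q))) :=
        add_le_add (sum_le_sum fun j _ => hother j) hfirst
    _ = 2 * (n / b) * (∑ j ∈ range J, ((j + 1 : ℕ) : ℝ)⁻¹)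
        + 4 * (J * q) * (1 + Real.log (2 * q)) + (4 * q + 4 * q * (1 + Real.log (2 * q))) := by
        rw [sum_add_distrib, sum_const, card_range, nsmul_eq_mul, ← mul_sum, ← mul_sum]
        ring
    _ ≤ 2 * (2 * (n / q)) * (3 * L) + 4 * (2 * X) * (4 * L) + (8 * (q * L) + 4 * q * (4 * L)) := by
        have h1 : 0 ≤ 1 + Real.log (2 * q) := by
          have : (1 : ℝ) ≤ q := by exact_mod_cast hq
          linarith [Real.log_nonneg (show (1 : ℝ) ≤ 2 * q by linarith)]
        have h2 : 4 * (q : ℝ) ≤ 8 * (q * L) := by nlinarith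
        gcongr
    _ ≤ 32 * L * ((n : ℝ) / q + X + q) := by
        have h1 : 0 ≤ (n : ℝ) / q * L := by positivity
        have h2 : 0 ≤ (q : ℝ) * L := by positivity
        nlinarith

/-! ### Vaughan's identity -/

/-- The restriction of an arithmetic function to the integers `m ≤ U`. -/
def truncLE (f : ArithmeticFunction ℝ) (U : ℕ) : ArithmeticFunction ℝ :=
  ⟨fun m => if m ≤ U then f m else 0, by simp⟩

theorem truncLE_apply (f : ArithmeticFunction ℝ) (U m : ℕ) :
    truncLE f U m = if m ≤ U then f m else 0 := rfl

theorem sub_truncLE_apply (f : ArithmeticFunction ℝ) (U m : ℕ) :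
    (f - truncLE f U) m = if m ≤ U then 0 else f m := by
  rw [sub_eq_add_neg, ArithmeticFunction.add_apply, ArithmeticFunction.neg_apply, truncLE_apply]
  split_ifs <;> simp

open ArithmeticFunction in
theorem vaughan_identity (U : ℕ) :
    vonMangoldt = truncLE vonMangoldt U + truncLE (moebius : ArithmeticFunction ℝ) U * log
      - truncLE (moebius : ArithmeticFunction ℝ) U * truncLE vonMangoldt U
          * (zeta : ArithmeticFunction ℝ)
      + ((moebius : ArithmeticFunction ℝ) - truncLE (moebius : ArithmeticFunction ℝ) U)
          * ((vonMangoldt - truncLE vonMangoldt U) * (zeta : ArithmeticFunction ℝ)) := by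
  have h1 : (moebius : ArithmeticFunction ℝ) * (zeta : ArithmeticFunction ℝ) = 1 :=
    coe_moebius_mul_coe_zeta
  have h2 : vonMangoldt * (zeta : ArithmeticFunction ℝ) = log := vonMangoldt_mul_zeta
  linear_combination (truncLE vonMangoldt U - vonMangoldt) * h1
    + truncLE (moebius : ArithmeticFunction ℝ) U * h2

/-- The exponential sum `∑_{m ≤ x} f(m) e(αm)`. -/
noncomputable def expSum (f : ArithmeticFunction ℝ) (α : ℝ) (x : ℕ) : ℂ :=
  ∑ m ∈ Ioc 0 x, (f m : ℂ) * eAdd (α * m)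

theorem expSum_add (f g : ArithmeticFunction ℝ) (α : ℝ) (x : ℕ) :
    expSum (f + g) α x = expSum f α x + expSum g α x := by
  simp [expSum, ArithmeticFunction.add_apply, add_mul, sum_add_distrib]

theorem expSum_sub (f g : ArithmeticFunction ℝ) (α : ℝ) (x : ℕ) :
    expSum (f - g) α x = expSum f α x - expSum g α x := by
  rw [eq_sub_iff_add_eq, ← expSum_add, sub_add_cancel]

theorem expSum_mul (f g : ArithmeticFunction ℝ) (α : ℝ) (x : ℕ) :
    expSum (f * g) α x = ∑ k ∈ Ioc 0 x, (f k : ℂ) *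
      ∑ l ∈ Ioc 0 (x / k), (g l : ℂ) * eAdd (α * k * l) := by
  have h1 : expSum (f * g) α x = ∑ m ∈ Ioc 0 x,
      ∑ p ∈ Ioc 0 x ×ˢ Ioc 0 x with p.1 * p.2 = m, (f p.1 : ℂ) * (g p.2 * eAdd (α * p.1 * p.2)) := by
    refine sum_congr rfl fun m hm => ?_
    rw [mem_Ioc] at hm
    rw [ArithmeticFunction.mul_apply, Nat.divisorsAntidiagonal_eq_prod_filter_of_le hm.1.ne' hm.2]
    push_cast
    rw [sum_mul]
    refine sum_congr rfl fun p hp => ?_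
    rw [← (mem_filter.1 hp).2]
    push_cast
    rw [mul_assoc α, mul_assoc]
  rw [h1]
  simp_rw [sum_filter]
  rw [sum_comm, sum_product]
  refine sum_congr rfl fun k hk => ?_
  rw [mem_Ioc] at hk
  rw [mul_sum]
  have hsub : Ioc 0 (x / k) ⊆ Ioc 0 x := Ioc_subset_Ioc_right (Nat.div_le_self x k)
  rw [← sum_subset hsub]
  · refine sum_congr rfl fun l hl => ?_
    rw [mem_Ioc, Nat.le_div_iff_mul_le hk.1] at hl
    rw [sum_ite_eq, if_pos]
    rw [mem_Ioc]
    exact ⟨Nat.mul_pos hk.1 hl.1, by rw [mul_comm]; exact hl.2⟩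
  · intro l hl hl'
    rw [mem_Ioc] at hl
    rw [mem_Ioc, Nat.le_div_iff_mul_le hk.1] at hl'
    rw [sum_ite_eq, if_neg]
    rw [mem_Ioc, mul_comm k]
    tauto

/-! ### Sums of type I -/

theorem norm_expSum_mul_le {f w : ArithmeticFunction ℝ} {α A B : ℝ} {n D x : ℕ} (hA : 0 ≤ A)
    (hB : 0 ≤ B) (hx : x ≤ n) (hf : ∀ k ≤ n, |f k| ≤ A) (hfD : ∀ k, D < k → f k = 0)
    (hw : ∀ k, 0 < k →
      ‖∑ l ∈ Ioc 0 (x / k), (w l : ℂ) * eAdd (α * k * l)‖ ≤ B * geomBound n α k) :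
    ‖expSum (f * w) α x‖ ≤ A * B * ∑ k ∈ range (D + 1), geomBound n α k := by
  have hAB (k : ℕ) : 0 ≤ A * (B * geomBound n α k) :=
    mul_nonneg hA (mul_nonneg hB (geomBound_nonneg _ _ _))
  rw [expSum_mul]
  calc _ ≤ ∑ k ∈ Ioc 0 x, ‖(f k : ℂ) * ∑ l ∈ Ioc 0 (x / k), (w l : ℂ) * eAdd (α * k * l)‖ :=
        norm_sum_le _ _
    _ ≤ ∑ k ∈ Ioc 0 x, if k ∈ range (D + 1) then A * (B * geomBound n α k) else 0 := by
        refine sum_le_sum fun k hk => ?_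
        rw [mem_Ioc] at hk
        rw [norm_mul, Complex.norm_real, Real.norm_eq_abs]
        split_ifs with h
        · exact mul_le_mul (hf k (hk.2.trans hx)) (hw k hk.1) (norm_nonneg _) hA
        · rw [hfD k (by simpa using h)]; simp
    _ = ∑ k ∈ Ioc 0 x with k ∈ range (D + 1), A * (B * geomBound n α k) := (sum_filter _ _).symm
    _ ≤ ∑ k ∈ range (D + 1), A * (B * geomBound n α k) :=
        sum_le_sum_of_subset_of_nonneg (fun k hk => (mem_filter.1 hk).2) fun k _ _ => hAB k
    _ = _ := by simp_rw [mul_sum, mul_assoc]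

theorem norm_sum_Ioc_div_eAdd_le {α : ℝ} {n x k m : ℕ} (hx : x ≤ n) (hm : m ≤ x / k) :
    ‖∑ l ∈ Ioc 0 m, eAdd (α * k * l)‖ ≤ geomBound n α k := by
  refine norm_sum_eAdd_le_minInv _ _ _ ?_
  refine (Nat.cast_le.2 (hm.trans (Nat.div_le_div_right hx))).trans ?_
  exact Nat.cast_div_le

theorem monotone_log_natCast : Monotone fun k : ℕ => Real.log k := by
  intro i j hij
  rcases Nat.eq_zero_or_pos i with rfl | hi
  · simpa using Real.log_natCast_nonneg j
  · exact Real.log_le_log (by exact_mod_cast hi) (by exact_mod_cast hij)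

theorem norm_sum_log_mul_eAdd_le {α : ℝ} {n x k : ℕ} (hx : x ≤ n) :
    ‖∑ l ∈ Ioc 0 (x / k), ((ArithmeticFunction.log l : ℝ) : ℂ) * eAdd (α * k * l)‖
      ≤ 2 * Real.log n * geomBound n α k := by
  have h := norm_sum_monotone_mul_le monotone_log_natCast Real.log_natCast_nonneg
    (z := fun l => eAdd (α * k * l)) (u := 0) (v := x / k)
    fun m hm => norm_sum_Ioc_div_eAdd_le (α := α) hx hm
  refine h.trans ?_
  have h2 : Real.log ((x / k : ℕ) : ℝ) ≤ Real.log n :=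
    monotone_log_natCast ((Nat.div_le_self x k).trans hx)
  have := geomBound_nonneg n α k
  gcongr

theorem norm_sum_zeta_mul_eAdd_le {α : ℝ} {n x k : ℕ} (hx : x ≤ n) :
    ‖∑ l ∈ Ioc 0 (x / k), (((ArithmeticFunction.zeta : ArithmeticFunction ℝ) l : ℝ) : ℂ)
      * eAdd (α * k * l)‖ ≤ 1 * geomBound n α k := by
  rw [one_mul]
  refine (congrArg norm (sum_congr rfl fun l hl => ?_)).trans_le
    (norm_sum_Ioc_div_eAdd_le (α := α) hx le_rfl)
  rw [ArithmeticFunction.natCoe_apply,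
    ArithmeticFunction.zeta_apply_ne (mem_Ioc.1 hl).1.ne']
  simp

theorem abs_truncLE_moebius_le (U k : ℕ) :
    |truncLE (ArithmeticFunction.moebius : ArithmeticFunction ℝ) U k| ≤ 1 := by
  rw [truncLE_apply]
  split_ifs
  · rw [ArithmeticFunction.intCoe_apply]
    exact_mod_cast ArithmeticFunction.abs_moebius_le_one
  · simp

theorem abs_mul_apply_le_log {f : ArithmeticFunction ℝ} (hf : ∀ k, |f k| ≤ 1)
    {g : ArithmeticFunction ℝ} (hg : ∀ k, |g k| ≤ ArithmeticFunction.vonMangoldt k) (m : ℕ) :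
    |(f * g) m| ≤ Real.log m := by
  rw [ArithmeticFunction.mul_apply, ← ArithmeticFunction.vonMangoldt_sum,
    ← Nat.sum_divisorsAntidiagonal' fun _ j => ArithmeticFunction.vonMangoldt j]
  refine (abs_sum_le_sum_abs _ _).trans (sum_le_sum fun p _ => ?_)
  rw [abs_mul]
  calc _ ≤ 1 * ArithmeticFunction.vonMangoldt p.2 :=
        mul_le_mul (hf _) (hg _) (abs_nonneg _) zero_le_one
    _ = _ := one_mul _

theorem abs_truncLE_vonMangoldt_le (U k : ℕ) :
    |truncLE ArithmeticFunction.vonMangoldt U k| ≤ ArithmeticFunction.vonMangoldt k := by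
  have := ArithmeticFunction.vonMangoldt_nonneg (n := k)
  rw [truncLE_apply]
  split_ifs
  · rw [abs_of_nonneg this]
  · simp [this]

theorem truncLE_mul_truncLE_apply_eq_zero (f g : ArithmeticFunction ℝ) {U m : ℕ} (hm : U * U < m) :
    (truncLE f U * truncLE g U) m = 0 := by
  rw [ArithmeticFunction.mul_apply]
  refine sum_eq_zero fun p hp => ?_
  rw [truncLE_apply, truncLE_apply]
  have h1 := (Nat.mem_divisorsAntidiagonal.1 hp).1
  split_ifs with h2 h3
  · have := Nat.mul_le_mul h2 h3
    omega
  all_goals simp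

theorem norm_expSum_truncLE_vonMangoldt_le {U n x : ℕ} (hU : U ≤ n) (α : ℝ) :
    ‖expSum (truncLE ArithmeticFunction.vonMangoldt U) α x‖ ≤ U * Real.log n := by
  have hle (m : ℕ) (hm : m ≤ U) : ArithmeticFunction.vonMangoldt m ≤ Real.log n :=
    ArithmeticFunction.vonMangoldt_le_log.trans (monotone_log_natCast (hm.trans hU))
  have hterm (m : ℕ) : ‖((truncLE ArithmeticFunction.vonMangoldt U m : ℝ) : ℂ) * eAdd (α * m)‖
      = if m ≤ U then ArithmeticFunction.vonMangoldt m else 0 := by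
    rw [norm_mul, norm_eAdd, mul_one, Complex.norm_real, truncLE_apply, Real.norm_eq_abs]
    split_ifs
    · exact abs_of_nonneg ArithmeticFunction.vonMangoldt_nonneg
    · simp
  calc _ ≤ ∑ m ∈ Ioc 0 x, if m ≤ U then ArithmeticFunction.vonMangoldt m else 0 := by
        refine (norm_sum_le _ _).trans_eq (sum_congr rfl fun m _ => hterm m)
    _ = ∑ m ∈ Ioc 0 x with m ≤ U, ArithmeticFunction.vonMangoldt m := (sum_filter _ _).symm
    _ ≤ ∑ m ∈ Ioc 0 U, ArithmeticFunction.vonMangoldt m := by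
        refine sum_le_sum_of_subset_of_nonneg ?_
          fun _ _ _ => ArithmeticFunction.vonMangoldt_nonneg
        intro m hm
        rw [mem_filter, mem_Ioc] at hm
        exact mem_Ioc.2 ⟨hm.1.1, hm.2⟩
    _ ≤ ∑ m ∈ Ioc 0 U, Real.log n := sum_le_sum fun m hm => hle m (mem_Ioc.1 hm).2
    _ = U * Real.log n := by simp

/-! ### Sums of type II -/

theorem sum_range_tsub_left_le {φ : ℕ → ℝ} (hφ : ∀ h, 0 ≤ φ h) (hφ0 : φ 0 = 0) {M m : ℕ}
    (hm : m < M) : ∑ l ∈ range M, φ (m - l) ≤ ∑ h ∈ range M, φ h := by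
  have h1 : ∑ l ∈ range M, φ (m - l) = ∑ l ∈ range (m + 1), φ (m - l) := by
    refine (sum_subset (range_subset_range.2 hm) fun l _ hl => ?_).symm
    rw [mem_range] at hl
    rw [Nat.sub_eq_zero_of_le (by omega), hφ0]
  have h2 : ∑ l ∈ range (m + 1), φ (m - l) = ∑ l ∈ range (m + 1), φ l := by
    simpa using sum_range_reflect φ (m + 1)
  rw [h1, h2]
  exact sum_le_sum_of_subset_of_nonneg (range_subset_range.2 hm) fun h _ _ => hφ h

theorem sum_range_tsub_right_le {φ : ℕ → ℝ} (hφ : ∀ h, 0 ≤ φ h) (hφ0 : φ 0 = 0) (M m : ℕ) :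
    ∑ l ∈ range M, φ (l - m) ≤ ∑ h ∈ range M, φ h := by
  induction m with
  | zero => simp
  | succ m ih =>
    refine le_trans ?_ ih
    rcases M with _ | M
    · simp
    · rw [sum_range_succ', sum_range_succ, Nat.zero_sub, hφ0, add_zero]
      simp_rw [Nat.add_sub_add_right]
      exact le_add_of_nonneg_right (hφ _)

theorem norm_sum_natCast_mul_eAdd_le (β : ℝ) (u v : ℕ) :
    ‖∑ k ∈ Ioc u v, ((k : ℝ) : ℂ) * eAdd (β * k)‖ ≤ 2 * v * minInv v (distInt β) :=
  norm_sum_monotone_mul_le Nat.mono_cast (fun k => Nat.cast_nonneg k) fun m hm =>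
    norm_sum_eAdd_le_minInv β u m (by exact_mod_cast hm)

theorem norm_sum_ite_natCast_mul_eAdd_le {α : ℝ} {n U x l₁ l₂ : ℕ} (hU : 1 ≤ U) (hx : x ≤ n)
    (h₁ : U < l₁) (h₂ : U < l₂) :
    ‖∑ k ∈ Ioc U x, if k * l₁ ≤ x ∧ k * l₂ ≤ x then
        ((k : ℝ) : ℂ) * (eAdd (α * k * l₁) * star (eAdd (α * k * l₂))) else 0‖
      ≤ 2 * (n * (l₂ : ℝ)⁻¹) * ((if l₁ = l₂ then (n : ℝ) / U else 0)
        + geomBound n α (l₁ - l₂) + geomBound n α (l₂ - l₁)) := by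
  have hl₁ : 0 < l₁ := by omega
  have hl₂ : 0 < l₂ := by omega
  set K := x / max l₁ l₂ with hK
  have hKx : K ≤ x := Nat.div_le_self _ _
  have hmem (k : ℕ) : k ≤ K ↔ k * l₁ ≤ x ∧ k * l₂ ≤ x := by
    rw [hK, Nat.le_div_iff_mul_le (by omega), ← Nat.mul_max_mul_left, max_le_iff]
  have hKdiv (d : ℕ) (hd : 0 < d) (hdm : d ≤ max l₁ l₂) : (K : ℝ) ≤ n / d := by
    have h1 : K * d ≤ n := (Nat.mul_le_mul_left K hdm).trans ((Nat.div_mul_le_self _ _).trans hx)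
    rw [le_div_iff₀ (by exact_mod_cast hd)]
    exact_mod_cast h1
  have hsum : (∑ k ∈ Ioc U x, if k * l₁ ≤ x ∧ k * l₂ ≤ x then
        ((k : ℝ) : ℂ) * (eAdd (α * k * l₁) * star (eAdd (α * k * l₂))) else 0)
      = ∑ k ∈ Ioc U K, ((k : ℝ) : ℂ) * eAdd (α * (l₁ - l₂) * k) := by
    rw [← sum_filter]
    refine sum_congr ?_ fun k _ => ?_
    · ext k
      rw [mem_filter, mem_Ioc, mem_Ioc, ← hmem]
      constructor
      · rintro ⟨⟨h, -⟩, h'⟩; exact ⟨h, h'⟩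
      · rintro ⟨h, h'⟩; exact ⟨⟨h, h'.trans hKx⟩, h'⟩
    · rw [star_eAdd, ← eAdd_add]
      ring_nf
  rw [hsum]
  refine (norm_sum_natCast_mul_eAdd_le _ _ _).trans ?_
  have hg₁ := geomBound_nonneg n α (l₁ - l₂)
  have hg₂ := geomBound_nonneg n α (l₂ - l₁)
  have hK2 : (K : ℝ) ≤ n * (l₂ : ℝ)⁻¹ := by
    rw [← div_eq_mul_inv]; exact hKdiv l₂ hl₂ (le_max_right _ _)
  refine mul_le_mul (by linarith) ?_ (minInv_nonneg (Nat.cast_nonneg K) _) (by positivity)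
  have hK0 : (0 : ℝ) ≤ K := Nat.cast_nonneg K
  rcases lt_trichotomy l₁ l₂ with h | h | h
  · have h3 : minInv K (distInt (α * (l₁ - l₂))) ≤ geomBound n α (l₂ - l₁) := by
      rw [geomBound, ← distInt_neg (α * (l₂ - l₁ : ℕ)), Nat.cast_sub h.le, ← mul_neg, neg_sub,
        ← Nat.cast_sub h.le]
      exact minInv_mono hK0 (hKdiv _ (by omega) (by omega)) _
    rw [if_neg h.ne]
    linarith
  · rw [if_pos h]
    have h3 := minInv_le hK0 (distInt (α * (l₁ - l₂)))
    have h4 : (K : ℝ) ≤ n / U := hKdiv U hU (by omega)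
    linarith
  · have h3 : minInv K (distInt (α * (l₁ - l₂))) ≤ geomBound n α (l₁ - l₂) := by
      rw [geomBound, ← Nat.cast_sub h.le]
      exact minInv_mono hK0 (hKdiv _ (by omega) (by omega)) _
    rw [if_neg h.ne']
    linarith

theorem sum_mul_norm_sq_le {g : ℕ → ℝ} {α B : ℝ} {n U x N : ℕ} (hU : 1 ≤ U) (hx : x ≤ n)
    (hN : N < n + 1) (hg : ∀ l ≤ n, |g l| ≤ B) (hgU : ∀ l ≤ U, g l = 0) {R : ℝ}
    (hR : ∑ h ∈ range (N + 1), geomBound n α h ≤ R) :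
    ∑ k ∈ Ioc U x, (k : ℝ) * ‖∑ l ∈ Ioc 0 N,
        if k * l ≤ x then (g l : ℂ) * eAdd (α * k * l) else 0‖ ^ 2
      ≤ B ^ 2 * (2 * n * (1 + Real.log N) * ((n : ℝ) / U + 2 * R)) := by
  have hR0 : 0 ≤ R := (sum_nonneg fun h _ => geomBound_nonneg n α h).trans hR
  set T : ℕ → ℕ → ℂ := fun l₁ l₂ => ∑ k ∈ Ioc U x, if k * l₁ ≤ x ∧ k * l₂ ≤ x then
    ((k : ℝ) : ℂ) * (eAdd (α * k * l₁) * star (eAdd (α * k * l₂))) else 0 with hT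
  have hexpand : ((∑ k ∈ Ioc U x, (k : ℝ) * ‖∑ l ∈ Ioc 0 N,
        if k * l ≤ x then (g l : ℂ) * eAdd (α * k * l) else 0‖ ^ 2 : ℝ) : ℂ)
      = ∑ l₂ ∈ Ioc 0 N, ∑ l₁ ∈ Ioc 0 N, (g l₁ : ℂ) * g l₂ * T l₁ l₂ := by
    simp only [hT, mul_sum]
    rw [Complex.ofReal_sum]
    have hk (k : ℕ) : (((k : ℝ) * ‖∑ l ∈ Ioc 0 N,
          if k * l ≤ x then (g l : ℂ) * eAdd (α * k * l) else 0‖ ^ 2 : ℝ) : ℂ)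
        = ∑ l₂ ∈ Ioc 0 N, ∑ l₁ ∈ Ioc 0 N, (g l₁ : ℂ) * g l₂ *
          if k * l₁ ≤ x ∧ k * l₂ ≤ x then
            ((k : ℝ) : ℂ) * (eAdd (α * k * l₁) * star (eAdd (α * k * l₂))) else 0 := by
      rw [Complex.ofReal_mul, Complex.ofReal_pow, ← Complex.mul_conj', map_sum, sum_mul_sum,
        sum_comm, mul_sum]
      refine sum_congr rfl fun l₂ _ => ?_
      rw [mul_sum]
      refine sum_congr rfl fun l₁ _ => ?_
      by_cases h1 : k * l₁ ≤ x <;> by_cases h2 : k * l₂ ≤ x <;> simp [h1, h2]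
      ring
    rw [sum_congr rfl fun k _ => hk k, sum_comm]
    exact sum_congr rfl fun l₂ _ => sum_comm
  have hrow (l₂ : ℕ) (h₂ : l₂ ∈ Ioc 0 N) : ∑ l₁ ∈ Ioc 0 N, ‖(g l₁ : ℂ) * g l₂ * T l₁ l₂‖
      ≤ B ^ 2 * (2 * (n * (l₂ : ℝ)⁻¹) * ((n : ℝ) / U + 2 * R)) := by
    rw [mem_Ioc] at h₂
    have hpos (l₁ : ℕ) : (0 : ℝ) ≤ (if l₁ = l₂ then (n : ℝ) / U else 0)
        + geomBound n α (l₁ - l₂) + geomBound n α (l₂ - l₁) :=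
      add_nonneg (add_nonneg (by split_ifs <;> positivity) (geomBound_nonneg _ _ _))
        (geomBound_nonneg _ _ _)
    calc _ ≤ ∑ l₁ ∈ Ioc 0 N, B ^ 2 * (2 * (n * (l₂ : ℝ)⁻¹) *
          ((if l₁ = l₂ then (n : ℝ) / U else 0)
            + geomBound n α (l₁ - l₂) + geomBound n α (l₂ - l₁))) := by
          refine sum_le_sum fun l₁ h₁ => ?_
          rw [mem_Ioc] at h₁
          have hnn := mul_nonneg (sq_nonneg B) (mul_nonneg
            (show (0 : ℝ) ≤ 2 * (n * (l₂ : ℝ)⁻¹) by positivity) (hpos l₁))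
          rcases le_or_gt l₁ U with h | h
          · simpa [hgU l₁ h] using hnn
          rcases le_or_gt l₂ U with h' | h'
          · simpa [hgU l₂ h'] using hnn
          rw [norm_mul, norm_mul, Complex.norm_real, Complex.norm_real, Real.norm_eq_abs,
            Real.norm_eq_abs, sq]
          have hb₁ := hg l₁ (by omega)
          have hb₂ := hg l₂ (by omega)
          have hB : 0 ≤ B := (abs_nonneg _).trans hb₁
          exact mul_le_mul (mul_le_mul hb₁ hb₂ (abs_nonneg _) hB)
            (norm_sum_ite_natCast_mul_eAdd_le hU hx h h') (norm_nonneg _) (mul_nonneg hB hB)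
      _ = B ^ 2 * (2 * (n * (l₂ : ℝ)⁻¹) * ∑ l₁ ∈ Ioc 0 N,
          ((if l₁ = l₂ then (n : ℝ) / U else 0)
            + geomBound n α (l₁ - l₂) + geomBound n α (l₂ - l₁))) := by rw [mul_sum, mul_sum]
      _ ≤ B ^ 2 * (2 * (n * (l₂ : ℝ)⁻¹) * ∑ l₁ ∈ range (N + 1),
          ((if l₁ = l₂ then (n : ℝ) / U else 0)
            + geomBound n α (l₁ - l₂) + geomBound n α (l₂ - l₁))) := by
          gcongr
          · exact fun i _ _ => hpos i
          · intro l hl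
            rw [mem_Ioc] at hl
            exact mem_range.2 (by omega)
      _ ≤ _ := by
          gcongr
          rw [sum_add_distrib, sum_add_distrib, sum_ite_eq', if_pos (mem_range.2 (by omega))]
          have e1 := sum_range_tsub_right_le (geomBound_nonneg n α) (geomBound_zero n α) (N + 1) l₂
          have e2 := sum_range_tsub_left_le (geomBound_nonneg n α) (geomBound_zero n α)
            (show l₂ < N + 1 by omega)
          linarith
  have hnonneg : 0 ≤ ∑ k ∈ Ioc U x, (k : ℝ) * ‖∑ l ∈ Ioc 0 N,
        if k * l ≤ x then (g l : ℂ) * eAdd (α * k * l) else 0‖ ^ 2 :=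
    sum_nonneg fun k _ => by positivity
  rw [← Real.norm_of_nonneg hnonneg, ← Complex.norm_real, hexpand]
  calc _ ≤ ∑ l₂ ∈ Ioc 0 N, ∑ l₁ ∈ Ioc 0 N, ‖(g l₁ : ℂ) * g l₂ * T l₁ l₂‖ :=
        (norm_sum_le _ _).trans (sum_le_sum fun _ _ => norm_sum_le _ _)
    _ ≤ ∑ l₂ ∈ Ioc 0 N, B ^ 2 * (2 * (n * (l₂ : ℝ)⁻¹) * ((n : ℝ) / U + 2 * R)) :=
        sum_le_sum hrow
    _ = B ^ 2 * (2 * n * (∑ l₂ ∈ Ioc 0 N, (l₂ : ℝ)⁻¹) * ((n : ℝ) / U + 2 * R)) := by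
        rw [mul_sum, sum_mul, mul_sum]
        exact sum_congr rfl fun l₂ _ => by ring
    _ ≤ _ := by
        gcongr
        exact sum_Ioc_inv_le_one_add_log N

theorem norm_expSum_mul_sq_le {f g : ArithmeticFunction ℝ} {α B : ℝ} {n U x : ℕ} (hU : 1 ≤ U)
    (hx : x ≤ n) (hf : ∀ k, |f k| ≤ 1) (hfU : ∀ k ≤ U, f k = 0) (hg : ∀ l ≤ n, |g l| ≤ B)
    (hgU : ∀ l ≤ U, g l = 0) {R : ℝ} (hR : ∑ h ∈ range (n / U + 1), geomBound n α h ≤ R) :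
    ‖expSum (f * g) α x‖ ^ 2 ≤ (1 + Real.log n) *
      (B ^ 2 * (2 * n * (1 + Real.log n) * ((n : ℝ) / U + 2 * R))) := by
  have hR0 : 0 ≤ R := (sum_nonneg fun h _ => geomBound_nonneg n α h).trans hR
  set A : ℕ → ℂ := fun k => ∑ l ∈ Ioc 0 (n / U),
    if k * l ≤ x then (g l : ℂ) * eAdd (α * k * l) else 0 with hA
  have hbound : ‖expSum (f * g) α x‖ ≤ ∑ k ∈ Ioc U x, ‖A k‖ := by
    have hsub : Ioc U x ⊆ Ioc 0 x := Ioc_subset_Ioc_left (Nat.zero_le U)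
    rw [expSum_mul, ← sum_subset hsub]
    · refine (norm_sum_le _ _).trans (sum_le_sum fun k hk => ?_)
      rw [mem_Ioc] at hk
      have hk0 : 0 < k := by omega
      have hAk : ∑ l ∈ Ioc 0 (x / k), (g l : ℂ) * eAdd (α * k * l) = A k := by
        simp only [hA]
        rw [← sum_filter]
        refine sum_congr ?_ fun _ _ => rfl
        ext l
        rw [mem_filter, mem_Ioc, mem_Ioc, Nat.le_div_iff_mul_le hk0, mul_comm l k]
        refine ⟨fun h => ⟨⟨h.1, ?_⟩, h.2⟩, fun h => ⟨h.1.1, h.2⟩⟩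
        rw [Nat.le_div_iff_mul_le hU, mul_comm]
        exact (Nat.mul_le_mul_right l hk.1.le).trans (h.2.trans hx)
      rw [norm_mul, Complex.norm_real, Real.norm_eq_abs, hAk]
      exact mul_le_of_le_one_left (norm_nonneg _) (hf k)
    · intro k hk hk'
      rw [mem_Ioc] at hk hk'
      rw [hfU k (by omega)]
      simp
  have hmain := sum_mul_norm_sq_le (N := n / U) hU hx (Nat.lt_succ_of_le (Nat.div_le_self n U))
    hg hgU hR
  have hlog (m : ℕ) (hm : m ≤ n) : Real.log m ≤ Real.log n := monotone_log_natCast hm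
  have hlog0 : 0 ≤ Real.log n := Real.log_natCast_nonneg n
  calc ‖expSum (f * g) α x‖ ^ 2 ≤ (∑ k ∈ Ioc U x, ‖A k‖) ^ 2 := by gcongr
    _ ≤ (∑ k ∈ Ioc U x, (k : ℝ)⁻¹) * ∑ k ∈ Ioc U x, (k : ℝ) * ‖A k‖ ^ 2 := by
        refine sum_sq_le_sum_mul_sum_of_sq_le_mul _ (fun k _ => by positivity)
          (fun k _ => by positivity) fun k hk => ?_
        have : (k : ℝ) ≠ 0 := by
          have := (mem_Ioc.1 hk).1
          exact_mod_cast (by omega : k ≠ 0)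
        exact le_of_eq (by field_simp)
    _ ≤ (1 + Real.log n) * (B ^ 2 * (2 * n * (1 + Real.log n) * ((n : ℝ) / U + 2 * R))) := by
        refine mul_le_mul ?_ (hmain.trans ?_) (sum_nonneg fun k _ => by positivity) (by linarith)
        · calc _ ≤ ∑ k ∈ Ioc 0 n, (k : ℝ)⁻¹ :=
              sum_le_sum_of_subset_of_nonneg (Ioc_subset_Ioc (Nat.zero_le U) hx)
                fun k _ _ => by positivity
            _ ≤ _ := sum_Ioc_inv_le_one_add_log n
        · gcongr B ^ 2 * (2 * n * (1 + ?_) * (n / U + 2 * R))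
          exact hlog _ (Nat.div_le_self n U)

/-! ### The exponential sum over primes -/

open ArithmeticFunction in
theorem norm_expSum_vonMangoldt_le {n : ℕ} (hn : 2 ≤ n) {α : ℝ} {a : ℤ} {q : ℕ} (hq : 1 ≤ q)
    (hqn : q ≤ n) (hgcd : Int.gcd a q = 1) (hα : |(q : ℝ) * α - a| ≤ 1 / q) {U x : ℕ}
    (hU : 1 ≤ U) (hUn : U * U ≤ n) (hx : x ≤ n) :
    ‖expSum vonMangoldt α x‖ ≤ U * Real.log n
      + 96 * Real.log n ^ 2 * ((n : ℝ) / q + (U * U : ℕ) + q)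
      + 36 * Real.log n ^ 3 * √(n * ((n : ℝ) / q + n / U + q)) := by
  set L := Real.log n with hL
  have hL1 : 2 / 3 ≤ L := two_thirds_le_log hn
  have hL0 : 0 ≤ L := by linarith
  have hUU : U ≤ U * U := Nat.le_mul_self U
  have hI := sum_geomBound_le hn hq hqn hgcd hα hUn
  have hII := sum_geomBound_le hn hq hqn hgcd hα (Nat.div_le_self n U)
  have h1 : ‖expSum (truncLE vonMangoldt U) α x‖ ≤ U * L :=
    norm_expSum_truncLE_vonMangoldt_le (hUU.trans hUn) α
  have h2 : ‖expSum (truncLE (moebius : ArithmeticFunction ℝ) U * log) α x‖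
      ≤ 1 * (2 * L) * ∑ k ∈ range (U * U + 1), geomBound n α k :=
    norm_expSum_mul_le zero_le_one (by positivity) hx (fun k _ => abs_truncLE_moebius_le U k)
      (fun k hk => by rw [truncLE_apply, if_neg (by omega)])
      fun k _ => norm_sum_log_mul_eAdd_le hx
  have h3 : ‖expSum (truncLE (moebius : ArithmeticFunction ℝ) U * truncLE vonMangoldt U
      * (zeta : ArithmeticFunction ℝ)) α x‖
      ≤ L * 1 * ∑ k ∈ range (U * U + 1), geomBound n α k :=
    norm_expSum_mul_le hL0 zero_le_one hx
      (fun k hk => (abs_mul_apply_le_log (abs_truncLE_moebius_le U)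
        (abs_truncLE_vonMangoldt_le U) k).trans (monotone_log_natCast hk))
      (fun k hk => truncLE_mul_truncLE_apply_eq_zero _ _ hk)
      fun k _ => norm_sum_zeta_mul_eAdd_le hx
  set W : ℝ := (n : ℝ) / q + n / U + q with hW
  have hW0 : 0 ≤ W := by positivity
  have h4 : ‖expSum (((moebius : ArithmeticFunction ℝ) - truncLE (moebius : ArithmeticFunction ℝ) U)
      * ((vonMangoldt - truncLE vonMangoldt U) * (zeta : ArithmeticFunction ℝ))) α x‖
      ≤ 36 * L ^ 3 * √(n * W) := by
    have hR : ∑ h ∈ range (n / U + 1), geomBound n α h ≤ 32 * L * W := by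
      refine hII.trans ?_
      have : ((n / U : ℕ) : ℝ) ≤ n / U := Nat.cast_div_le
      gcongr
      simp only [hW]
      linarith
    have hsq := norm_expSum_mul_sq_le (f := (moebius : ArithmeticFunction ℝ)
      - truncLE (moebius : ArithmeticFunction ℝ) U)
      (g := (vonMangoldt - truncLE vonMangoldt U) * (zeta : ArithmeticFunction ℝ)) (B := L)
      hU hx ?_ ?_ ?_ ?_ hR
    · refine abs_le_of_sq_le_sq' ?_ (by positivity) |>.2
      refine hsq.trans ?_
      have e1 : (n : ℝ) / U ≤ W := by
        have : 0 ≤ (n : ℝ) / q := by positivity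
        have : (0 : ℝ) ≤ q := by positivity
        simp only [hW]
        linarith
      have e2 : 1 + L ≤ 5 / 2 * L := by linarith
      have e3 : (n : ℝ) / U + 2 * (32 * L * W) ≤ 66 * (L * W) := by nlinarith
      calc (1 + L) * (L ^ 2 * (2 * n * (1 + L) * ((n : ℝ) / U + 2 * (32 * L * W))))
          ≤ (5 / 2 * L) * (L ^ 2 * (2 * n * (5 / 2 * L) * (66 * (L * W)))) := by gcongr
        _ = 825 * (L ^ 5 * (n * W)) := by ring
        _ ≤ 1296 * L * (L ^ 5 * (n * W)) := by
          gcongr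
          linarith
        _ = (36 * L ^ 3 * √(n * W)) ^ 2 := by
          rw [mul_pow, Real.sq_sqrt (by positivity)]
          ring
    · intro k
      rw [sub_truncLE_apply]
      split_ifs
      · simp
      · rw [intCoe_apply]
        exact_mod_cast abs_moebius_le_one
    · intro k hk
      rw [sub_truncLE_apply, if_pos hk]
    · intro l hl
      rw [mul_comm]
      refine (abs_mul_apply_le_log ?_ ?_ l).trans (monotone_log_natCast hl)
      · intro k
        rcases eq_or_ne k 0 with rfl | h
        · simp
        · simp [zeta_apply_ne h]
      · intro k
        have := vonMangoldt_nonneg (n := k)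
        rw [sub_truncLE_apply]
        split_ifs
        · simp [this]
        · rw [abs_of_nonneg this]
    · intro l hl
      rw [coe_mul_zeta_apply]
      refine sum_eq_zero fun d hd => ?_
      rw [sub_truncLE_apply, if_pos ((Nat.divisor_le hd).trans hl)]
  rw [vaughan_identity U, expSum_add, expSum_sub, expSum_add]
  refine (norm_add_le _ _).trans (add_le_add ((norm_sub_le _ _).trans ?_) h4)
  have h5 := norm_add_le (expSum (truncLE vonMangoldt U) α x)
    (expSum (truncLE (moebius : ArithmeticFunction ℝ) U * log) α x)
  nlinarith

theorem norm_expSum_vonMangoldt_sub_le {n x : ℕ} (hx : x ≤ n) (α : ℝ) :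
    ‖expSum ArithmeticFunction.vonMangoldt α x
      - ∑ p ∈ Ioc 0 x with p.Prime, (Real.log p : ℂ) * eAdd (α * p)‖ ≤ 2 * √n * Real.log n := by
  have hlog0 : 0 ≤ Real.log n := Real.log_natCast_nonneg n
  rcases Nat.eq_zero_or_pos x with rfl | hx0
  · simp [expSum]; positivity
  have h1 : expSum ArithmeticFunction.vonMangoldt α x
      - ∑ p ∈ Ioc 0 x with p.Prime, (Real.log p : ℂ) * eAdd (α * p)
      = ∑ m ∈ Ioc 0 x with ¬ m.Prime,
        ((ArithmeticFunction.vonMangoldt m : ℝ) : ℂ) * eAdd (α * m) := by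
    rw [expSum, ← sum_filter_add_sum_filter_not (Ioc 0 x) Nat.Prime, add_sub_assoc, add_comm,
      sub_add, sub_eq_self, sub_eq_zero]
    refine sum_congr rfl fun p hp => ?_
    rw [ArithmeticFunction.vonMangoldt_apply_prime (mem_filter.1 hp).2]
  have h2 := Chebyshev.psi_sub_theta_eq_sum_not_prime x
  have h3 := Chebyshev.psi_sub_theta_le (x := x) (by exact_mod_cast hx0)
  rw [h1]
  calc _ ≤ ∑ m ∈ Ioc 0 x with ¬ m.Prime, ArithmeticFunction.vonMangoldt m := by
        refine (norm_sum_le _ _).trans_eq (sum_congr rfl fun m _ => ?_)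
        rw [norm_mul, norm_eAdd, mul_one, Complex.norm_real,
          Real.norm_of_nonneg ArithmeticFunction.vonMangoldt_nonneg]
    _ ≤ 2 * √x * Real.log x := by
        rw [Nat.floor_natCast] at h2
        rw [← h2]; exact h3
    _ ≤ 2 * √n * Real.log n := by
        gcongr

theorem norm_primeExpSum_le {n : ℕ} {α B : ℝ}
    (hB : ∀ x ≤ n, ‖∑ p ∈ Ioc 0 x with p.Prime, (Real.log p : ℂ) * eAdd (α * p)‖ ≤ B) :
    ‖primeExpSum n α‖ ≤ 3 / 2 * B := by
  have hB0 : 0 ≤ B := (norm_nonneg _).trans (hB 0 (Nat.zero_le n))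
  have hmax (k : ℕ) : 0 < Real.log (max k 2 : ℕ) :=
    Real.log_pos (by exact_mod_cast (by omega : 1 < max k 2))
  have hsum : primeExpSum n α = ∑ k ∈ Ioc 0 n, (((Real.log (max k 2 : ℕ))⁻¹ : ℝ) : ℂ) *
      if k.Prime then (Real.log k : ℂ) * eAdd (α * k) else 0 := by
    simp_rw [mul_ite, mul_zero]
    rw [← sum_filter, primeExpSum]
    refine sum_congr ?_ fun p hp => ?_
    · ext p
      simp only [mem_filter, mem_range, mem_Ioc, Nat.lt_succ_iff]
      exact ⟨fun h => ⟨⟨h.2.pos, h.1⟩, h.2⟩, fun h => ⟨h.1.2, h.2⟩⟩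
    · have h2 := (mem_filter.1 hp).2.two_le
      have h3 := hmax p
      rw [max_eq_left h2] at h3 ⊢
      rw [← mul_assoc, ← Complex.ofReal_mul, inv_mul_cancel₀ h3.ne', Complex.ofReal_one, one_mul]
  rw [hsum]
  refine (norm_sum_antitone_mul_le (B := B) ?_ (fun k => (inv_pos.2 (hmax k)).le) ?_).trans ?_
  · intro i j hij
    exact inv_anti₀ (hmax i) (monotone_log_natCast (max_le_max hij le_rfl))
  · intro m hm
    rw [← sum_filter]
    exact hB m hm
  · refine mul_le_mul_of_nonneg_right ?_ hB0
    have h := two_thirds_le_log (n := max 0 2) (by simp)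
    calc (Real.log (max 0 2 : ℕ))⁻¹ ≤ (2 / 3)⁻¹ := inv_anti₀ (by norm_num) h
      _ = 3 / 2 := by norm_num

/-- The choice `U = ⌊n ^ (2 / 5)⌋` balances the terms in the estimate for `∑ Λ(m) e(αm)`. -/
theorem exists_vaughan_parameter {n q : ℕ} (hq : 1 ≤ q) (hqn : q ≤ n) {E : ℝ}
    (hE : E = (n : ℝ) * (q : ℝ) ^ (-(1 : ℝ) / 2) + (n : ℝ) ^ ((4 : ℝ) / 5)
      + (n : ℝ) ^ ((1 : ℝ) / 2) * (q : ℝ) ^ ((1 : ℝ) / 2)) :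
    ∃ U : ℕ, 1 ≤ U ∧ U * U ≤ n ∧ (U : ℝ) ≤ E ∧ √n ≤ E ∧ (n : ℝ) / q + (U * U : ℕ) + q ≤ E
      ∧ √(n * ((n : ℝ) / q + n / U + q)) ≤ 2 * E := by
  have hq1 : (1 : ℝ) ≤ q := by exact_mod_cast hq
  have hqn' : (q : ℝ) ≤ n := by exact_mod_cast hqn
  have hn1 : (1 : ℝ) ≤ n := hq1.trans hqn'
  have hn0 : (0 : ℝ) ≤ n := by linarith
  obtain ⟨v, hv⟩ : ∃ v : ℝ, v = (n : ℝ) ^ ((1 : ℝ) / 5) := ⟨_, rfl⟩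
  have hv1 : 1 ≤ v := hv ▸ Real.one_le_rpow hn1 (by norm_num)
  have hv5 : v ^ 5 = n := by
    rw [hv, ← Real.rpow_natCast, ← Real.rpow_mul hn0]
    norm_num
  have hv4 : (n : ℝ) ^ ((4 : ℝ) / 5) = v ^ 4 := by
    rw [hv, ← Real.rpow_natCast, ← Real.rpow_mul hn0]
    norm_num
  obtain ⟨s, hs⟩ : ∃ s : ℝ, s = √q := ⟨_, rfl⟩
  obtain ⟨r, hr⟩ : ∃ r : ℝ, r = √n := ⟨_, rfl⟩
  have hs1 : 1 ≤ s := hs ▸ Real.one_le_sqrt.2 hq1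
  have hr1 : 1 ≤ r := hr ▸ Real.one_le_sqrt.2 hn1
  have hs2 : s ^ 2 = q := hs ▸ Real.sq_sqrt (by linarith)
  have hr2 : r ^ 2 = n := hr ▸ Real.sq_sqrt hn0
  have hsr : s ≤ r := hs ▸ hr ▸ Real.sqrt_le_sqrt hqn'
  have hqs : (q : ℝ) ^ (-(1 : ℝ) / 2) = s⁻¹ := by
    rw [hs, Real.sqrt_eq_rpow, ← Real.rpow_neg (by linarith)]
    norm_num
  rw [hv4, hqs, ← Real.sqrt_eq_rpow, ← Real.sqrt_eq_rpow, ← hs, ← hr] at hE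
  have hA0 : 0 ≤ (n : ℝ) * s⁻¹ := by positivity
  have hD0 : 0 ≤ r * s := by positivity
  have hE0 : 0 ≤ E := by rw [hE]; positivity
  set U := ⌊v ^ 2⌋₊ with hU
  have hUle : (U : ℝ) ≤ v ^ 2 := Nat.floor_le (by positivity)
  have hU1 : 1 ≤ U := Nat.le_floor (by rw [Nat.cast_one]; exact one_le_pow₀ hv1)
  have hU1' : (1 : ℝ) ≤ U := by exact_mod_cast hU1
  have hUge : v ^ 2 ≤ 2 * U := by linarith [Nat.lt_floor_add_one (v ^ 2)]
  have hUU : ((U * U : ℕ) : ℝ) ≤ v ^ 4 := by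
    push_cast
    nlinarith
  have hUn : U * U ≤ n := by
    have h45 : v ^ 4 ≤ v ^ 5 := pow_le_pow_right₀ hv1 (by norm_num)
    exact_mod_cast hUU.trans (h45.trans_eq hv5)
  have hnq : (n : ℝ) / q ≤ n * s⁻¹ := by
    rw [div_eq_mul_inv, ← hs2]
    have : (s ^ 2)⁻¹ ≤ s⁻¹ := inv_anti₀ (by linarith) (by nlinarith)
    gcongr
  have hqle : (q : ℝ) ≤ r * s := by nlinarith
  have hI : (n : ℝ) / q + (U * U : ℕ) + q ≤ E := by linarith
  have hUE : (U : ℝ) ≤ E := by nlinarith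
  have hrE : √n ≤ E := by
    rw [← hr]
    have : 0 ≤ v ^ 4 := by positivity
    nlinarith
  have hII : √(n * ((n : ℝ) / q + n / U + q)) ≤ 2 * E := by
    rw [Real.sqrt_le_left (by positivity)]
    have e1 : (n : ℝ) * (n / q) = (n * s⁻¹) ^ 2 := by
      rw [← hs2]
      field_simp
    have e2 : (n : ℝ) * q = (r * s) ^ 2 := by rw [mul_pow, hr2, hs2]
    have e3 : (n : ℝ) * (n / U) ≤ 2 * (v ^ 4) ^ 2 := by
      rw [← mul_div_assoc, div_le_iff₀ (by linarith)]
      calc (n : ℝ) * n = v ^ 8 * v ^ 2 := by rw [← hv5]; ring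
        _ ≤ v ^ 8 * (2 * U) := by gcongr
        _ = 2 * (v ^ 4) ^ 2 * U := by ring
    have e4 : 0 ≤ v ^ 4 := by positivity
    rw [mul_add, mul_add, e1, e2, hE]
    linarith [mul_nonneg hA0 e4, mul_nonneg hA0 hD0, mul_nonneg e4 hD0, e3,
      sq_nonneg ((n : ℝ) * s⁻¹), sq_nonneg (v ^ 4), sq_nonneg (r * s)]
  exact ⟨U, hU1, hUn, hUE, hrE, hI, hII⟩

theorem vinogradov_vaughan_exponential_sum_bound :
    ∃ C : ℝ, 0 < C ∧ ∀ n : ℕ, 2 ≤ n → ∀ α : ℝ, ∀ a : ℤ, ∀ q : ℕ,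
      1 ≤ q → q ≤ n → Int.gcd a q = 1 → |(q : ℝ) * α - (a : ℝ)| ≤ 1 / q →
        ‖primeExpSum n α‖ ≤ C * (Real.log n) ^ 3 *
          ((n : ℝ) * (q : ℝ) ^ (-(1:ℝ)/2) + (n : ℝ) ^ ((4:ℝ)/5) +
            (n : ℝ) ^ ((1:ℝ)/2) * (q : ℝ) ^ ((1:ℝ)/2)) := by
  refine ⟨400, by norm_num, fun n hn α a q hq hqn hgcd hα => ?_⟩
  set L := Real.log n with hL
  have hL1 : 2 / 3 ≤ L := two_thirds_le_log hn
  have hL0 : 0 ≤ L := by linarith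
  obtain ⟨E, hE⟩ : ∃ E : ℝ, E = (n : ℝ) * (q : ℝ) ^ (-(1 : ℝ) / 2) + (n : ℝ) ^ ((4 : ℝ) / 5)
      + (n : ℝ) ^ ((1 : ℝ) / 2) * (q : ℝ) ^ ((1 : ℝ) / 2) := ⟨_, rfl⟩
  obtain ⟨U, hU1, hUn, hUE, hrE, hI, hII⟩ := exists_vaughan_parameter hq hqn hE
  have hE0 : 0 ≤ E := (Real.sqrt_nonneg _).trans hrE
  rw [← hE]
  have hL23 : L ^ 2 ≤ 3 / 2 * L ^ 3 := by nlinarith [sq_nonneg L]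
  have hL13 : L ≤ 9 / 4 * L ^ 3 := by nlinarith [sq_nonneg L]
  have hbound (x : ℕ) (hx : x ≤ n) :
      ‖∑ p ∈ Ioc 0 x with p.Prime, (Real.log p : ℂ) * eAdd (α * p)‖ ≤ 230 * (L ^ 3 * E) := by
    have h1 := norm_expSum_vonMangoldt_le hn hq hqn hgcd hα hU1 hUn hx
    have h2 := norm_expSum_vonMangoldt_sub_le hx α
    have h3 := norm_sub_norm_le (∑ p ∈ Ioc 0 x with p.Prime, (Real.log p : ℂ) * eAdd (α * p))
      (expSum ArithmeticFunction.vonMangoldt α x)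
    rw [norm_sub_rev] at h3
    have e1 : U * L ≤ E * (9 / 4 * L ^ 3) := mul_le_mul hUE hL13 hL0 hE0
    have e2 : 96 * L ^ 2 * ((n : ℝ) / q + (U * U : ℕ) + q) ≤ 96 * (3 / 2 * L ^ 3) * E := by
      gcongr
    have e3 : 36 * L ^ 3 * √(n * ((n : ℝ) / q + n / U + q)) ≤ 36 * L ^ 3 * (2 * E) := by
      gcongr
    have e4 : 2 * √n * L ≤ 2 * E * (9 / 4 * L ^ 3) := by gcongr
    have e5 : 0 ≤ L ^ 3 * E := by positivity
    linarith
  have hfin := norm_primeExpSum_le hbound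
  have : 0 ≤ L ^ 3 * E := by positivity
  linarith
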